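/- Let p > 0, K ⊆ ℝ⁺ a p-convex set, h : (0,∞) → ℝ a nonnegative super-multiplicative function, f an operator (p,h)-convex function on K, wᵢ > 0 (i = 1,…,k) weights with each partial sum in the domain of h, Aᵢ positive semidefinite matrices with spectra in K, and M_L = {1,…,L}. Then F(M_k) ≤ F(M_{k-1}) ≤ … ≤ F(M₂) ≤ 0, where F(S) = h(W_S)·f([W_S⁻¹ Σ_{i∈S} wᵢ Aᵢ^p]^{1/p}) − Σ_{i∈S} h(wᵢ) f(Aᵢ) and W_S = Σ_{i∈S} wᵢ. -/

import Mathlib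

open Matrix
open scoped ComplexOrder

/-- The matrix `A` raised to the real power `p`, defined via the continuous
functional calculus (using the real power function `Real.rpow`). -/
noncomputable def mpow {n : ℕ} (A : Matrix (Fin n) (Fin n) ℂ) (p : ℝ) :
    Matrix (Fin n) (Fin n) ℂ :=
  cfc (fun x : ℝ => x ^ p) A

/-- The Loewner order on matrices: `loewnerLE X Y` iff `Y - X` is positive semidefinite. -/
def loewnerLE {n : ℕ} (X Y : Matrix (Fin n) (Fin n) ℂ) : Prop :=
  (Y - X).PosSemidef

/-- A set `K ⊆ ℝ` is `p`-convex if `(l*x^p + (1-l)*y^p)^(1/p) ∈ K` for all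
`x, y ∈ K` and `l ∈ [0,1]`. -/
def PConvex (p : ℝ) (K : Set ℝ) : Prop :=
  ∀ x ∈ K, ∀ y ∈ K, ∀ l ∈ Set.Icc (0 : ℝ) 1,
    (l * x ^ p + (1 - l) * y ^ p) ^ (1 / p) ∈ K

/-- `h` is super-multiplicative on `J`: `h (x*y) ≥ h x * h y` for all `x, y ∈ J`. -/
def SuperMultiplicativeOn (J : Set ℝ) (h : ℝ → ℝ) : Prop :=
  ∀ x ∈ J, ∀ y ∈ J, h x * h y ≤ h (x * y)

/-- `f` is operator `(p,h)`-convex on `K`: `f` is nonnegative and continuous on `K`, and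
`f([α A^p + (1-α) B^p]^{1/p}) ≤ h(α) f(A) + h(1-α) f(B)` (in the Loewner order) for all
positive semidefinite matrices `A, B` (of any order `n`) with spectra in `K` and all
`α ∈ (0,1)`, where matrix functions are taken via the continuous functional calculus. -/
def OperatorPHConvexOn (p : ℝ) (K : Set ℝ) (h : ℝ → ℝ) (f : ℝ → ℝ) : Prop :=
  (∀ x ∈ K, 0 ≤ f x) ∧ ContinuousOn f K ∧
  ∀ (n : ℕ) (A B : Matrix (Fin n) (Fin n) ℂ),
    A.PosSemidef → B.PosSemidef → spectrum ℝ A ⊆ K → spectrum ℝ B ⊆ K →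
    ∀ α ∈ Set.Ioo (0 : ℝ) 1,
      loewnerLE (cfc f (mpow (α • mpow A p + (1 - α) • mpow B p) (1 / p)))
        (h α • cfc f A + h (1 - α) • cfc f B)

/-- The index set function
`F(S) = h(W_S) • f([W_S⁻¹ ∑_{i ∈ S} wᵢ Aᵢ^p]^{1/p}) − ∑_{i ∈ S} h(wᵢ) • f(Aᵢ)`,
where `W_S = ∑_{i ∈ S} wᵢ`. -/
noncomputable def idxF (p : ℝ) (h f : ℝ → ℝ) {n : ℕ} (w : ℕ → ℝ)
    (A : ℕ → Matrix (Fin n) (Fin n) ℂ) (S : Finset ℕ) : Matrix (Fin n) (Fin n) ℂ :=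
  h (∑ i ∈ S, w i) •
      cfc f (mpow ((∑ i ∈ S, w i)⁻¹ • ∑ i ∈ S, w i • mpow (A i) p) (1 / p))
    - ∑ i ∈ S, h (w i) • cfc f (A i)

open scoped MatrixOrder in
/-- Hermitian matrices with spectrum in a convex set form a convex set. -/
lemma convex_setOf_isHermitian_spectrum_subset {n : ℕ} {T : Set ℝ} (hT : Convex ℝ T) :
    Convex ℝ {X : Matrix (Fin n) (Fin n) ℂ | X.IsHermitian ∧ spectrum ℝ X ⊆ T} := by
  rintro X ⟨hX, hXT⟩ Y ⟨hY, hYT⟩ a b ha hb hab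
  have hX' : IsSelfAdjoint X := hX
  have hY' : IsSelfAdjoint Y := hY
  have hZ : IsSelfAdjoint (a • X + b • Y) :=
    ((IsSelfAdjoint.all a).smul hX').add ((IsSelfAdjoint.all b).smul hY')
  refine ⟨hZ, fun z hz => ?_⟩
  rcases n.eq_zero_or_pos with rfl | hn
  · simp [spectrum.of_subsingleton] at hz
  have : Nonempty (Fin n) := ⟨⟨0, hn⟩⟩
  have hfin : (spectrum ℝ X ∪ spectrum ℝ Y).Finite :=
    X.finite_real_spectrum.union Y.finite_real_spectrum
  have hne : (spectrum ℝ X ∪ spectrum ℝ Y).Nonempty :=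
    (ContinuousFunctionalCalculus.spectrum_nonempty X hX').mono Set.subset_union_left
  have hsub : spectrum ℝ X ∪ spectrum ℝ Y ⊆ T := Set.union_subset hXT hYT
  obtain ⟨m, hm, hm'⟩ := Set.exists_min_image _ id hfin hne
  obtain ⟨M, hM, hM'⟩ := Set.exists_max_image _ id hfin hne
  have comb (c : ℝ) : algebraMap ℝ (Matrix (Fin n) (Fin n) ℂ) c
      = a • algebraMap ℝ _ c + b • algebraMap ℝ _ c := by
    rw [← add_smul, hab, one_smul]
  have lower : algebraMap ℝ _ m ≤ a • X + b • Y := by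
    rw [comb m]
    exact add_le_add
      (smul_le_smul_of_nonneg_left
        ((algebraMap_le_iff_le_spectrum hX').2 fun x hx => hm' x (Or.inl hx)) ha)
      (smul_le_smul_of_nonneg_left
        ((algebraMap_le_iff_le_spectrum hY').2 fun x hx => hm' x (Or.inr hx)) hb)
  have upper : a • X + b • Y ≤ algebraMap ℝ _ M := by
    rw [comb M]
    exact add_le_add
      (smul_le_smul_of_nonneg_left
        ((le_algebraMap_iff_spectrum_le hX').2 fun x hx => hM' x (Or.inl hx)) ha)
      (smul_le_smul_of_nonneg_left
        ((le_algebraMap_iff_spectrum_le hY').2 fun x hx => hM' x (Or.inr hx)) hb)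
  exact hT.ordConnected.out (hsub hm) (hsub hM)
    ⟨(algebraMap_le_iff_le_spectrum hZ).1 lower z hz,
      (le_algebraMap_iff_spectrum_le hZ).1 upper z hz⟩

lemma PConvex.convex_image_rpow {p : ℝ} {K : Set ℝ} (hKp : PConvex p K) (hp : 0 < p)
    (hK : K ⊆ Set.Ici 0) : Convex ℝ ((fun x : ℝ => x ^ p) '' K) := by
  rintro _ ⟨x, hx, rfl⟩ _ ⟨y, hy, rfl⟩ a b ha hb hab
  obtain rfl : b = 1 - a := by linarith
  refine ⟨_, hKp x hx y hy a ⟨ha, by linarith⟩, ?_⟩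
  have hx0 := Real.rpow_nonneg (hK hx) p
  have hy0 := Real.rpow_nonneg (hK hy) p
  simp only [smul_eq_mul]
  rw [← Real.rpow_mul (by positivity), one_div_mul_cancel hp.ne', Real.rpow_one]

lemma continuous_rpow_const_of_pos {p : ℝ} (hp : 0 < p) : Continuous fun x : ℝ => x ^ p :=
  Real.continuous_rpow_const hp.le

lemma isSelfAdjoint_mpow {n : ℕ} (A : Matrix (Fin n) (Fin n) ℂ) (p : ℝ) :
    IsSelfAdjoint (mpow A p) :=
  cfc_predicate _ A

lemma spectrum_mpow {n : ℕ} {A : Matrix (Fin n) (Fin n) ℂ} (hA : IsSelfAdjoint A) {p : ℝ}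
    (hp : 0 < p) : spectrum ℝ (mpow A p) = (fun x : ℝ => x ^ p) '' spectrum ℝ A :=
  cfc_map_spectrum _ A hA (continuous_rpow_const_of_pos hp).continuousOn

lemma mpow_mpow_of_mul_eq_one {n : ℕ} {A : Matrix (Fin n) (Fin n) ℂ} (hA : IsSelfAdjoint A)
    (hs : spectrum ℝ A ⊆ Set.Ici 0) {p q : ℝ} (hp : 0 < p) (hq : 0 < q) (hpq : p * q = 1) :
    mpow (mpow A p) q = A := by
  unfold mpow
  rw [← cfc_comp' (fun x : ℝ => x ^ q) (fun x : ℝ => x ^ p) A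
    (continuous_rpow_const_of_pos hq).continuousOn (continuous_rpow_const_of_pos hp).continuousOn]
  calc cfc (fun x : ℝ => (x ^ p) ^ q) A = cfc id A := cfc_congr fun x hx => by
        simp only [id]
        rw [← Real.rpow_mul (hs hx), hpq, Real.rpow_one]
    _ = A := cfc_id ℝ A

open scoped MatrixOrder in
lemma posSemidef_cfc {n : ℕ} {f : ℝ → ℝ} {A : Matrix (Fin n) (Fin n) ℂ}
    (hf : ∀ x ∈ spectrum ℝ A, 0 ≤ f x) : (cfc f A).PosSemidef :=
  Matrix.nonneg_iff_posSemidef.1 (cfc_nonneg hf)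

open scoped MatrixOrder in
lemma posSemidef_of_spectrum_subset {n : ℕ} {A : Matrix (Fin n) (Fin n) ℂ}
    (hA : IsSelfAdjoint A) (hs : spectrum ℝ A ⊆ Set.Ici 0) : A.PosSemidef := by
  rw [← cfc_id ℝ A]
  exact posSemidef_cfc hs

/-- The weighted power mean of matrices `A i` with spectra in a `p`-convex set `K`, raised
to the power `p`, is Hermitian with spectrum in `K ^ p`. -/
lemma spectrum_weighted_sum_mpow_subset {n : ℕ} {p : ℝ} (hp : 0 < p) {K : Set ℝ}
    (hK : K ⊆ Set.Ici 0) (hKp : PConvex p K) {S : Finset ℕ} (hS : S.Nonempty) {w : ℕ → ℝ}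
    {A : ℕ → Matrix (Fin n) (Fin n) ℂ} (hw : ∀ i ∈ S, 0 < w i)
    (hA : ∀ i ∈ S, (A i).PosSemidef) (hsA : ∀ i ∈ S, spectrum ℝ (A i) ⊆ K) :
    IsSelfAdjoint ((∑ i ∈ S, w i)⁻¹ • ∑ i ∈ S, w i • mpow (A i) p) ∧
      spectrum ℝ ((∑ i ∈ S, w i)⁻¹ • ∑ i ∈ S, w i • mpow (A i) p)
        ⊆ (fun x : ℝ => x ^ p) '' K :=
  (convex_setOf_isHermitian_spectrum_subset (hKp.convex_image_rpow hp hK)).centerMass_mem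
    (fun i hi => (hw i hi).le) (Finset.sum_pos hw hS) fun i hi =>
      ⟨isSelfAdjoint_mpow _ _, by
        rw [spectrum_mpow (hA i hi).isHermitian hp]
        exact Set.image_mono (hsA i hi)⟩

/-- Adjoining one index to `S` decreases the index set function. -/
lemma loewnerLE_idxF_insert {n : ℕ} {p : ℝ} (hp : 0 < p) {K : Set ℝ} (hK : K ⊆ Set.Ici 0)
    (hKp : PConvex p K) {h : ℝ → ℝ} (hh0 : ∀ x : ℝ, 0 < x → 0 ≤ h x)
    (hsm : ∀ x y : ℝ, 0 < x → 0 < y → h x * h y ≤ h (x * y))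
    {f : ℝ → ℝ} (hf : OperatorPHConvexOn p K h f) {S : Finset ℕ} (hS : S.Nonempty) {j : ℕ}
    (hj : j ∉ S) {w : ℕ → ℝ} {A : ℕ → Matrix (Fin n) (Fin n) ℂ}
    (hw : ∀ i ∈ insert j S, 0 < w i) (hA : ∀ i ∈ insert j S, (A i).PosSemidef)
    (hsA : ∀ i ∈ insert j S, spectrum ℝ (A i) ⊆ K) :
    loewnerLE (idxF p h f w A (insert j S)) (idxF p h f w A S) := by
  have hwS : ∀ i ∈ S, 0 < w i := fun i hi => hw i (Finset.mem_insert_of_mem hi)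
  have hwj : 0 < w j := hw j (Finset.mem_insert_self j S)
  have hAj := hA j (Finset.mem_insert_self j S)
  have hsAj := hsA j (Finset.mem_insert_self j S)
  obtain ⟨hXsa, hXs⟩ := spectrum_weighted_sum_mpow_subset hp hK hKp hS hwS
    (fun i hi => hA i (Finset.mem_insert_of_mem hi))
    (fun i hi => hsA i (Finset.mem_insert_of_mem hi))
  have hV : 0 < ∑ i ∈ S, w i := Finset.sum_pos hwS hS
  unfold loewnerLE idxF
  rw [Finset.sum_insert hj, Finset.sum_insert hj, Finset.sum_insert hj]
  set V := ∑ i ∈ S, w i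
  set Q := ∑ i ∈ S, w i • mpow (A i) p
  set R := ∑ i ∈ S, h (w i) • cfc f (A i)
  have hinv : 0 < 1 / p := by positivity
  have hX0 : spectrum ℝ (V⁻¹ • Q) ⊆ Set.Ici 0 := fun x hx => by
    obtain ⟨y, hy, rfl⟩ := hXs hx
    exact Real.rpow_nonneg (hK hy) p
  set C := mpow (V⁻¹ • Q) (1 / p) with hC
  have hCs : spectrum ℝ C ⊆ K := by
    rw [hC, spectrum_mpow hXsa hinv]
    rintro _ ⟨x, hx, rfl⟩
    obtain ⟨y, hy, rfl⟩ := hXs hx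
    simp only
    rwa [← Real.rpow_mul (hK hy), mul_one_div_cancel hp.ne', Real.rpow_one]
  have hCp : mpow C p = V⁻¹ • Q :=
    mpow_mpow_of_mul_eq_one hXsa hX0 hinv hp (one_div_mul_cancel hp.ne')
  have hCpos : C.PosSemidef :=
    posSemidef_of_spectrum_subset (isSelfAdjoint_mpow _ _) (hCs.trans hK)
  have hW : 0 < w j + V := by positivity
  have hα : w j / (w j + V) ∈ Set.Ioo (0 : ℝ) 1 :=
    ⟨by positivity, (div_lt_one hW).2 (by linarith)⟩
  have hα' : 1 - w j / (w j + V) = V / (w j + V) := by field_simp; ring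
  have key := hf.2.2 n (A j) C hAj hCpos hsAj hCs _ hα
  have hmean : (w j / (w j + V)) • mpow (A j) p + (1 - w j / (w j + V)) • mpow C p
      = (w j + V)⁻¹ • (w j • mpow (A j) p + Q) := by
    rw [hα', hCp, smul_smul, smul_add, smul_smul]
    congr 2 <;> field_simp
  rw [hmean, hα'] at key
  unfold loewnerLE at key
  have hfA : (cfc f (A j)).PosSemidef := posSemidef_cfc fun x hx => hf.1 x (hsAj hx)
  have hfC : (cfc f C).PosSemidef := posSemidef_cfc fun x hx => hf.1 x (hCs hx)
  have hmul (v : ℝ) (hv : 0 < v) : 0 ≤ h v - h (w j + V) * h (v / (w j + V)) := by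
    have := hsm (w j + V) (v / (w j + V)) hW (by positivity)
    rw [mul_div_cancel₀ _ hW.ne'] at this
    linarith
  convert ((key.smul (hh0 _ hW)).add (hfA.smul (hmul _ hwj))).add (hfC.smul (hmul _ hV)) using 1
  module

lemma idxF_singleton {n : ℕ} {p : ℝ} (hp : 0 < p) (h f : ℝ → ℝ) {w : ℕ → ℝ}
    {A : ℕ → Matrix (Fin n) (Fin n) ℂ} {j : ℕ} (hw : 0 < w j) (hA : (A j).IsHermitian)
    (hs : spectrum ℝ (A j) ⊆ Set.Ici 0) : idxF p h f w A {j} = 0 := by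
  have hA' : IsSelfAdjoint (A j) := hA
  simp only [idxF, Finset.sum_singleton]
  rw [inv_smul_smul₀ hw.ne', mpow_mpow_of_mul_eq_one hA' hs hp (by positivity)
    (mul_one_div_cancel hp.ne'), sub_self]

/-- For `M_L = {1, …, L}`, the chain `F(M_k) ≤ F(M_{k-1}) ≤ … ≤ F(M₂) ≤ 0` holds,
where `F(S) = h(W_S) f([W_S⁻¹ ∑_{i∈S} wᵢ Aᵢ^p]^{1/p}) − ∑_{i∈S} h(wᵢ) f(Aᵢ)`. -/
theorem stmt9 (p : ℝ) (hp : 0 < p) (K : Set ℝ) (hK : K ⊆ Set.Ici 0) (hKp : PConvex p K)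
    (h : ℝ → ℝ) (hh0 : ∀ x : ℝ, 0 < x → 0 ≤ h x)
    (hsm : ∀ x y : ℝ, 0 < x → 0 < y → h x * h y ≤ h (x * y))
    (f : ℝ → ℝ) (hf : OperatorPHConvexOn p K h f)
    (k : ℕ) (hk : 2 ≤ k)
    (n : ℕ) (w : ℕ → ℝ) (A : ℕ → Matrix (Fin n) (Fin n) ℂ)
    (hw : ∀ i, 1 ≤ i → i ≤ k → 0 < w i)
    (hA : ∀ i, 1 ≤ i → i ≤ k → (A i).PosSemidef)
    (hsA : ∀ i, 1 ≤ i → i ≤ k → spectrum ℝ (A i) ⊆ K) :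
    (∀ L, 2 ≤ L → L < k →
      loewnerLE (idxF p h f w A (Finset.Icc 1 (L + 1))) (idxF p h f w A (Finset.Icc 1 L)))
    ∧ loewnerLE (idxF p h f w A (Finset.Icc 1 2)) 0 := by
  have step (L : ℕ) (hL : 1 ≤ L) (hLk : L < k) :
      loewnerLE (idxF p h f w A (Finset.Icc 1 (L + 1))) (idxF p h f w A (Finset.Icc 1 L)) := by
    have hmem : ∀ i ∈ insert (L + 1) (Finset.Icc 1 L), 1 ≤ i ∧ i ≤ k := by
      intro i hi
      simp only [Finset.mem_insert, Finset.mem_Icc] at hi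
      omega
    rw [← Finset.insert_Icc_right_eq_Icc_add_one (by omega : 1 ≤ L + 1)]
    exact loewnerLE_idxF_insert hp hK hKp hh0 hsm hf (Finset.nonempty_Icc.2 hL) (by simp)
      (fun i hi => hw i (hmem i hi).1 (hmem i hi).2)
      (fun i hi => hA i (hmem i hi).1 (hmem i hi).2)
      (fun i hi => hsA i (hmem i hi).1 (hmem i hi).2)
  refine ⟨fun L hL => step L (by omega), ?_⟩
  have h1k : 1 ≤ k := by omega
  have base := step 1 le_rfl (by omega)
  rwa [Finset.Icc_self, idxF_singleton hp h f (hw 1 le_rfl h1k) (hA 1 le_rfl h1k).isHermitian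
    ((hsA 1 le_rfl h1k).trans hK)] at base
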